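/- Superpolynomial decay of the archimedean transform for φ < π/2: Fix η > 40, H ∈ C_η, α = (α₁, α₂, α₃) ∈ ℂ³ with Re α_i = 0 and α₁ + α₂ + α₃ = 0, δ ∈ {+1, −1}, φ ∈ (0, π/2), and T ≥ 1000. Then for every N > 0 there exists a constant C > 0 (depending on N, T, φ, η, α, H) such that |(F_α^{(δ)} H)(s₀, s; φ)| ≤ C · (1 + |Im s₀|)^{−N} for all (s₀, s) with Re s₀ > 1/100, Re s < 4, 2·Re s − Re s₀ − 1/100 > 0, and |Im s| < T. -/

import Mathlib

open Complex MeasureTheory Set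

/-- `Γ_ℝ(s) := π^{−s/2} Γ(s/2)`. -/
noncomputable def GammaR (s : ℂ) : ℂ := (Real.pi : ℂ) ^ (-s / 2) * Complex.Gamma (s / 2)

/-- The K-Bessel function `K_μ(x) = ∫₀^∞ exp(−x cosh t) cosh(μt) dt`. -/
noncomputable def KBessel (μ : ℂ) (x : ℝ) : ℂ :=
  ∫ t in Ioi (0:ℝ), Complex.exp (-(x : ℂ) * (Real.cosh t : ℂ)) * Complex.cosh (μ * (t : ℂ))

/-- The GL(2) Whittaker function `W_μ(y) = 2√y K_μ(2πy)`. -/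
noncomputable def W2 (μ : ℂ) (y : ℝ) : ℂ :=
  2 * (Real.sqrt y : ℂ) * KBessel μ (2 * Real.pi * y)

/-- The class `C_η` of test functions. -/
def MemCeta (η : ℝ) (H : ℂ → ℂ) : Prop :=
  DifferentiableOn ℂ H {μ : ℂ | |μ.re| < 2 * η} ∧
  (∀ μ : ℂ, |μ.re| < 2 * η → H (-μ) = H μ) ∧
  ∃ C : ℝ, ∀ μ : ℂ, |μ.re| < 2 * η → ‖H μ‖ ≤ C * Real.exp (-2 * Real.pi * |μ.im|)

/-- The inverse Kontorovich–Lebedev transform. -/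
noncomputable def Hflat (H : ℂ → ℂ) (y : ℝ) : ℂ :=
  (1 / (4 * (Real.pi : ℂ))) * ∫ t : ℝ,
    H (t * I) * W2 (t * I) y / (Complex.Gamma (t * I) * Complex.Gamma (-(t * I)))

/-- Mellin transform `ĥ(w) := ∫₀^∞ h(y) y^{w−1} dy`. -/
noncomputable def mellinT (h : ℝ → ℂ) (w : ℂ) : ℂ :=
  ∫ y in Ioi (0:ℝ), h y * (y : ℂ) ^ (w - 1)

/-- The Mellin kernel `G_α(s₀,s₁)` of the GL(3) Whittaker function. -/
noncomputable def Gfun (α : Fin 3 → ℂ) (s0 s1 : ℂ) : ℂ :=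
  (∏ i, GammaR (s0 + α i) * GammaR (s1 - α i)) / GammaR (s0 + s1)

/-- The Gamma-kernel `𝒢_α^{(δ)}(s₁, u; s₀, s; φ)` of the archimedean transform. -/
noncomputable def GkerPhi (α : Fin 3 → ℂ) (δ φ : ℝ) (s1 u s0 s : ℂ) : ℂ :=
  Gfun α (s0 - u) s1 * (2 * (Real.pi : ℂ)) ^ (-u) *
    Complex.exp (Complex.I * δ * φ * u) * Complex.Gamma u *
    Complex.Gamma ((u + 1 - 2 * s + s1 - s0) / 2) *
    Complex.Gamma ((2 * s - s0 - u) / 2) / Complex.Gamma ((1 + s1) / 2 - s0)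

/-- The archimedean transform `(F_α^{(δ)} H)(s₀, s; φ)`, a double integral over
`s₁ = 15 + it₁` and `u = 1/100 + iv`. -/
noncomputable def FtransPhi (α : Fin 3 → ℂ) (δ φ : ℝ) (H : ℂ → ℂ) (s0 s : ℂ) : ℂ :=
  (1 / (2 * (Real.pi : ℂ))) ^ 2 *
    ∫ t1 : ℝ, ∫ v : ℝ,
      mellinT (Hflat H) (s - (15 + t1 * Complex.I) - 1/2) *
        GkerPhi α δ φ (15 + t1 * Complex.I) (1/100 + v * Complex.I) s0 s

theorem integrable_exp_neg_mul_abs {c : ℝ} (hc : 0 < c) :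
    Integrable fun t : ℝ => Real.exp (-c * |t|) := by
  rw [← integrableOn_univ, ← Iic_union_Ioi (a := (0 : ℝ)), integrableOn_union]
  constructor
  · refine (integrableOn_exp_mul_Iic hc 0).congr_fun (fun t ht => ?_) measurableSet_Iic
    simp only [mem_Iic] at ht
    simp [abs_of_nonpos ht]
  · refine (integrableOn_exp_mul_Ioi (neg_lt_zero.mpr hc) 0).congr_fun (fun t ht => ?_)
      measurableSet_Ioi
    simp only [mem_Ioi] at ht
    simp [abs_of_pos ht]

theorem integrable_vertical {f : ℂ → ℂ} {S : Set ℝ} {a B c : ℝ} (hc : 0 < c) (ha : a ∈ S)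
    (hf : ContinuousOn f {z | z.re ∈ S})
    (hB : ∀ z : ℂ, z.re ∈ S → ‖f z‖ ≤ B * Real.exp (-c * |z.im|)) :
    Integrable fun t : ℝ => f (a + t * I) := by
  refine ((integrable_exp_neg_mul_abs hc).const_mul B).mono' ?_ (.of_forall fun t => ?_)
  · refine Continuous.aestronglyMeasurable (hf.comp_continuous (by fun_prop) fun t => ?_)
    simpa using ha
  · simpa using hB (a + t * I) (by simpa using ha)

/-- The integral over a vertical line of a function with exponential decay does not depend on
the line. -/
theorem integral_vertical_eq {f : ℂ → ℂ} {a b B c : ℝ} (hc : 0 < c)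
    (hf : DifferentiableOn ℂ f {z | z.re ∈ uIcc a b})
    (hB : ∀ z : ℂ, z.re ∈ uIcc a b → ‖f z‖ ≤ B * Real.exp (-c * |z.im|)) :
    ∫ t : ℝ, f (a + t * I) = ∫ t : ℝ, f (b + t * I) := by
  have lim (d : ℝ) (hd : d ∈ uIcc a b) := intervalIntegral_tendsto_integral
    (integrable_vertical hc hd hf.continuousOn hB) Filter.tendsto_neg_atTop_atBot
      Filter.tendsto_id
  have hlim := (lim b right_mem_uIcc).sub (lim a left_mem_uIcc)
  have hzero : Filter.Tendsto (fun R : ℝ => (∫ t in (-R)..(id R), f (b + t * I)) -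
      ∫ t in (-R)..(id R), f (a + t * I)) Filter.atTop (nhds 0) := by
    refine squeeze_zero_norm' (a := fun R => 2 * (B * |b - a|) * Real.exp (-c * R)) ?_ ?_
    · filter_upwards [Filter.eventually_ge_atTop 0] with R hR
      have hrect := integral_boundary_rect_eq_zero_of_differentiableOn f (a + (-R : ℝ) * I)
        (b + R * I) (hf.mono fun z hz => by simpa using hz.1)
      have hbd (y : ℝ) (hy : |y| = R) : ‖∫ x in a..b, f (x + y * I)‖
          ≤ B * Real.exp (-c * R) * |b - a| := by
        refine intervalIntegral.norm_integral_le_of_norm_le_const fun x hx => ?_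
        simpa [hy] using hB (x + y * I) (by simpa using uIoc_subset_uIcc hx)
      have h1 := hbd (-R) (by simp [abs_of_nonneg hR])
      have h2 := hbd R (abs_of_nonneg hR)
      simp only [add_re, ofReal_re, mul_re, I_re, mul_zero, ofReal_im, I_im, mul_one, sub_self,
        add_zero, add_im, mul_im, zero_add, smul_eq_mul] at hrect
      have : (∫ t in (-R)..R, f (b + t * I)) - ∫ t in (-R)..R, f (a + t * I)
          = I * ((∫ x in a..b, f (x + (-R : ℝ) * I)) - ∫ x in a..b, f (x + R * I)) := by
        linear_combination (-I) * hrect + (((∫ t in (-R)..R, f (b + t * I)) -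
          ∫ t in (-R)..R, f (a + t * I))) * I_sq
      simp only [id, this, norm_mul, norm_I, one_mul]
      refine (norm_sub_le _ _).trans ?_
      linarith
    · have := (Real.tendsto_exp_neg_atTop_nhds_zero.comp
        (Filter.tendsto_id.const_mul_atTop hc)).const_mul (2 * (B * |b - a|))
      simpa [Function.comp_def] using this
  exact (sub_eq_zero.mp (tendsto_nhds_unique hlim hzero)).symm

theorem exists_add_pow_le_exp (A : ℝ) (hA : 0 ≤ A) (m : ℕ) {ε : ℝ} (hε : 0 < ε) :
    ∃ C : ℝ, 0 < C ∧ ∀ x : ℝ, 0 ≤ x → (A + x) ^ m ≤ C * Real.exp (ε * x) := by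
  refine ⟨m.factorial * Real.exp (ε * A) / ε ^ m, by positivity, fun x hx => ?_⟩
  have h := Real.pow_div_factorial_le_exp (ε * (A + x)) (by positivity) m
  rw [div_le_iff₀ (by positivity), mul_pow, mul_add, Real.exp_add] at h
  rw [div_mul_eq_mul_div, le_div_iff₀ (by positivity)]
  linarith

theorem norm_betaIntegral_le (s w : ℂ) :
    ‖betaIntegral s w‖ ≤ ‖betaIntegral s.re w.re‖ := by
  have hnorm (s w : ℂ) : ∀ x ∈ Ioo (0 : ℝ) 1,
      ‖(x : ℂ) ^ (s - 1) * (1 - (x : ℂ)) ^ (w - 1)‖ = x ^ (s.re - 1) * (1 - x) ^ (w.re - 1) := by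
    intro x hx
    rw [norm_mul, norm_cpow_eq_rpow_re_of_pos hx.1, ← ofReal_one, ← ofReal_sub,
      norm_cpow_eq_rpow_re_of_pos (sub_pos.mpr hx.2)]
    simp
  have hreal : betaIntegral s.re w.re
      = ((∫ x in Ioo (0 : ℝ) 1, x ^ (s.re - 1) * (1 - x) ^ (w.re - 1) : ℝ) : ℂ) := by
    rw [betaIntegral, intervalIntegral.integral_of_le zero_le_one, integral_Ioc_eq_integral_Ioo]
    refine Eq.trans ?_ integral_ofReal
    refine setIntegral_congr_fun measurableSet_Ioo fun x hx => ?_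
    have h1 : (0 : ℝ) ≤ 1 - x := sub_nonneg.mpr hx.2.le
    simp only [coe_algebraMap]
    push_cast [ofReal_cpow hx.1.le, ofReal_cpow h1]
    rfl
  rw [hreal, norm_real, Real.norm_eq_abs]
  refine le_trans ?_ (le_abs_self _)
  rw [betaIntegral, intervalIntegral.integral_of_le zero_le_one, integral_Ioc_eq_integral_Ioo]
  exact (norm_integral_le_integral_norm _).trans_eq
    (setIntegral_congr_fun measurableSet_Ioo (hnorm s w))

/-- The quotient `|Γ(σ + it)| / Γ(σ)` is nondecreasing in `σ`. -/
theorem norm_Gamma_mul_Gamma_re_le {s : ℂ} {w : ℝ} (hs : 0 < s.re) (hw : 0 < w) :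
    ‖Gamma s‖ * Real.Gamma (s.re + w) ≤ ‖Gamma (s + w)‖ * Real.Gamma s.re := by
  have h1 := congrArg norm (Gamma_mul_Gamma_eq_betaIntegral hs (t := w) (by simpa using hw))
  have h2 := congrArg norm (Gamma_mul_Gamma_eq_betaIntegral (s := s.re) (t := w)
    (by simpa using hs) (by simpa using hw))
  have hb := norm_betaIntegral_le s w
  rw [← ofReal_add] at h2
  simp only [norm_mul, Gamma_ofReal, norm_real, Real.norm_eq_abs, ofReal_re,
    abs_of_pos (Real.Gamma_pos_of_pos hs), abs_of_pos (Real.Gamma_pos_of_pos hw),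
    abs_of_pos (Real.Gamma_pos_of_pos (add_pos hs hw))] at h1 h2 hb
  have hGw := Real.Gamma_pos_of_pos hw
  refine le_of_mul_le_mul_right ?_ hGw
  have hGsw := Real.Gamma_pos_of_pos (add_pos hs hw)
  calc ‖Gamma s‖ * Real.Gamma (s.re + w) * Real.Gamma w
      = ‖Gamma (s + w)‖ * (Real.Gamma (s.re + w) * ‖betaIntegral s w‖) := by
        linear_combination Real.Gamma (s.re + w) * h1
    _ ≤ ‖Gamma (s + w)‖ * (Real.Gamma (s.re + w) * ‖betaIntegral s.re w‖) := by gcongr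
    _ = ‖Gamma (s + w)‖ * Real.Gamma s.re * Real.Gamma w := by
        linear_combination -‖Gamma (s + w)‖ * h2

theorem norm_Gamma_half_add_sq (t : ℝ) :
    ‖Gamma (1 / 2 + t * I)‖ ^ 2 = Real.pi / Real.cosh (Real.pi * t) := by
  have h := congrArg norm (Gamma_mul_Gamma_one_sub (1 / 2 + t * I))
  have hconj : 1 - (1 / 2 + t * I) = (starRingEnd ℂ) (1 / 2 + t * I) := by
    apply Complex.ext <;> simp
    norm_num
  have hsin : sin (Real.pi * (1 / 2 + t * I)) = Real.cosh (Real.pi * t) := by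
    rw [show (Real.pi : ℂ) * (1 / 2 + t * I) = Real.pi * t * I + Real.pi / 2 by ring,
      Complex.sin_add_pi_div_two, Complex.cos_mul_I]
    push_cast
    rfl
  rw [hconj, Gamma_conj, hsin, norm_mul, RCLike.norm_conj, norm_div, norm_real, norm_real,
    Real.norm_eq_abs, Real.norm_eq_abs, abs_of_pos Real.pi_pos,
    abs_of_pos (Real.cosh_pos _)] at h
  rw [sq, h]

theorem Real.cosh_le_exp_abs (x : ℝ) : Real.cosh x ≤ Real.exp |x| := by
  rw [← Real.cosh_abs, Real.cosh_eq]
  have : Real.exp (-|x|) ≤ Real.exp |x| := Real.exp_le_exp.mpr (by linarith [abs_nonneg x])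
  linarith

theorem Real.exp_abs_le_two_mul_cosh (x : ℝ) : Real.exp |x| ≤ 2 * Real.cosh x := by
  rw [← Real.cosh_abs, Real.cosh_eq]
  linarith [Real.exp_pos (-|x|)]

theorem norm_Gamma_half_add_le (t : ℝ) :
    ‖Gamma (1 / 2 + t * I)‖ ≤ 3 * Real.exp (-(Real.pi / 2) * |t|) := by
  refine le_of_sq_le_sq ?_ (by positivity)
  rw [norm_Gamma_half_add_sq, div_le_iff₀ (Real.cosh_pos _), mul_pow, ← Real.exp_nat_mul]
  have h := Real.exp_abs_le_two_mul_cosh (Real.pi * t)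
  rw [abs_mul, abs_of_pos Real.pi_pos] at h
  have hmul : Real.exp (((2 : ℕ) : ℝ) * (-(Real.pi / 2) * |t|)) * Real.exp (Real.pi * |t|) = 1 := by
    rw [← Real.exp_add, Real.exp_eq_one_iff]
    push_cast
    ring
  have := mul_le_mul_of_nonneg_left h
    (Real.exp_pos (((2 : ℕ) : ℝ) * (-(Real.pi / 2) * |t|))).le
  nlinarith [Real.pi_lt_four]

theorem le_norm_Gamma_half_add (t : ℝ) :
    Real.exp (-(Real.pi / 2) * |t|) ≤ ‖Gamma (1 / 2 + t * I)‖ := by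
  refine le_of_sq_le_sq ?_ (norm_nonneg _)
  rw [norm_Gamma_half_add_sq, le_div_iff₀ (Real.cosh_pos _), ← Real.exp_nat_mul]
  have h := Real.cosh_le_exp_abs (Real.pi * t)
  rw [abs_mul, abs_of_pos Real.pi_pos] at h
  have hmul : Real.exp (((2 : ℕ) : ℝ) * (-(Real.pi / 2) * |t|)) * Real.exp (Real.pi * |t|) = 1 := by
    rw [← Real.exp_add, Real.exp_eq_one_iff]
    push_cast
    ring
  have := mul_le_mul_of_nonneg_left h
    (Real.exp_pos (((2 : ℕ) : ℝ) * (-(Real.pi / 2) * |t|))).le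
  linarith [Real.pi_gt_three]

theorem norm_Gamma_add_nat_le (m : ℕ) (t : ℝ) :
    ‖Gamma (1 / 2 + t * I + m)‖ ≤ (m + 1 + |t|) ^ m * ‖Gamma (1 / 2 + t * I)‖ := by
  have key (k : ℕ) (hk : k ≤ m) :
      ‖Gamma (1 / 2 + t * I + k)‖ ≤ (m + 1 + |t|) ^ k * ‖Gamma (1 / 2 + t * I)‖ := by
    induction k with
    | zero => simp
    | succ k ih =>
      have hne : 1 / 2 + t * I + (k : ℂ) ≠ 0 := by
        intro h
        have := congrArg re h
        simp at this
        linarith [(Nat.cast_nonneg k : (0 : ℝ) ≤ k)]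
      have hk' : (k : ℝ) + 1 ≤ m := by exact_mod_cast hk
      have hle : ‖1 / 2 + t * I + (k : ℂ)‖ ≤ m + 1 + |t| := by
        refine (norm_add₃_le).trans ?_
        simp
        linarith
      rw [Nat.cast_succ, ← add_assoc, Gamma_add_one _ hne, norm_mul, pow_succ', mul_assoc]
      exact mul_le_mul hle (ih (Nat.le_of_succ_le hk)) (norm_nonneg _) (by positivity)
  exact key m le_rfl

theorem continuousOn_Gamma_Icc {a b : ℝ} (ha : 0 < a) :
    ContinuousOn Real.Gamma (Icc a b) := fun x hx =>
  (Real.differentiableAt_Gamma fun m h => by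
    linarith [ha.trans_le hx.1, (Nat.cast_nonneg m : (0 : ℝ) ≤ m)]).continuousAt.continuousWithinAt

/-- Exponential decay of `Γ` in vertical strips. -/
theorem exists_norm_Gamma_le {a b ε : ℝ} (ha : 0 < a) (hε : 0 < ε) :
    ∃ C : ℝ, 0 < C ∧ ∀ s : ℂ, a ≤ s.re → s.re ≤ b →
      ‖Gamma s‖ ≤ C * Real.exp (-(Real.pi / 2 - ε) * |s.im|) := by
  obtain ⟨m, hm⟩ := exists_nat_ge b
  obtain ⟨C₁, hC₁⟩ :=
    isCompact_Icc.exists_bound_of_continuousOn (continuousOn_Gamma_Icc (b := b) ha)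
  obtain ⟨C₂, hC₂, hpow⟩ := exists_add_pow_le_exp (m + 1) (by positivity) m hε
  have hG : 0 < Real.Gamma (m + 1 / 2) := Real.Gamma_pos_of_pos (by positivity)
  refine ⟨C₂ * 3 * (|C₁| + 1) / Real.Gamma (m + 1 / 2), by positivity, fun s hs₁ hs₂ => ?_⟩
  have hs : 0 < s.re := ha.trans_le hs₁
  have hmono := norm_Gamma_mul_Gamma_re_le (w := m + 1 / 2 - s.re) hs (by linarith)
  have hadd : s + ((m + 1 / 2 - s.re : ℝ) : ℂ) = 1 / 2 + s.im * I + m := by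
    apply Complex.ext <;> simp
    ring
  rw [hadd, show s.re + (m + 1 / 2 - s.re) = (m : ℝ) + 1 / 2 by ring] at hmono
  have h1 : Real.Gamma s.re ≤ |C₁| + 1 :=
    ((le_abs_self _).trans (hC₁ _ ⟨hs₁, hs₂⟩)).trans (by linarith [le_abs_self C₁])
  have h2 : ‖Gamma (1 / 2 + s.im * I + m)‖
      ≤ C₂ * 3 * Real.exp (-(Real.pi / 2 - ε) * |s.im|) := by
    refine (norm_Gamma_add_nat_le m s.im).trans ?_
    calc _ ≤ (C₂ * Real.exp (ε * |s.im|)) * (3 * Real.exp (-(Real.pi / 2) * |s.im|)) := by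
          gcongr
          · exact hpow _ (abs_nonneg _)
          · exact norm_Gamma_half_add_le _
      _ = _ := by
        rw [show -(Real.pi / 2 - ε) * |s.im| = ε * |s.im| + -(Real.pi / 2) * |s.im| by ring,
          Real.exp_add]
        ring
  rw [div_mul_eq_mul_div, le_div_iff₀ hG]
  calc _ ≤ _ := hmono
    _ ≤ (C₂ * 3 * Real.exp (-(Real.pi / 2 - ε) * |s.im|)) * (|C₁| + 1) := by
      gcongr
    _ = _ := by ring

/-- Exponential growth bound for `1 / Γ` in vertical strips. -/
theorem exists_norm_Gamma_inv_le {b ε : ℝ} (hε : 0 < ε) :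
    ∃ C : ℝ, 0 < C ∧ ∀ s : ℂ, 0 < s.re → s.re ≤ b →
      ‖(Gamma s)⁻¹‖ ≤ C * Real.exp ((Real.pi / 2 + ε) * |s.im|) := by
  obtain ⟨C₁, hC₁⟩ := isCompact_Icc.exists_bound_of_continuousOn
    (f := fun x => (Real.Gamma x)⁻¹) (s := Icc 1 (b + 1))
    ((continuousOn_Gamma_Icc one_pos).inv₀
      fun x hx => (Real.Gamma_pos_of_pos (one_pos.trans_le hx.1)).ne')
  obtain ⟨C₂, hC₂, hpow⟩ := exists_add_pow_le_exp |b| (abs_nonneg _) 1 hε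
  have hG : 0 < Real.Gamma (1 / 2) := Real.Gamma_pos_of_pos (by norm_num)
  refine ⟨C₂ * (|C₁| + 1) * Real.Gamma (1 / 2), by positivity, fun s hs₁ hs₂ => ?_⟩
  have hs0 : s ≠ 0 := fun h => by simp [h] at hs₁
  have hmono := norm_Gamma_mul_Gamma_re_le (s := 1 / 2 + s.im * I) (w := s.re + 1 / 2)
    (by simp) (by linarith)
  have hadd : 1 / 2 + s.im * I + ((s.re + 1 / 2 : ℝ) : ℂ) = s + 1 := by
    apply Complex.ext <;> simp
    ring
  have hre : (1 / 2 + s.im * I : ℂ).re = 1 / 2 := by simp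
  rw [hadd, hre, show 1 / 2 + (s.re + 1 / 2) = s.re + 1 by ring, Gamma_add_one s hs0,
    norm_mul] at hmono
  have hGs : 0 < ‖Gamma s‖ := norm_pos_iff.mpr (Gamma_ne_zero_of_re_pos hs₁)
  have hGr : 0 < Real.Gamma (s.re + 1) := Real.Gamma_pos_of_pos (by linarith)
  have h1 : (Real.Gamma (s.re + 1))⁻¹ ≤ |C₁| + 1 :=
    ((le_abs_self _).trans (hC₁ _ ⟨by linarith, by linarith⟩)).trans (by linarith [le_abs_self C₁])
  have h2 : ‖s‖ ≤ C₂ * Real.exp (ε * |s.im|) := by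
    refine le_trans ?_ (hpow _ (abs_nonneg _))
    rw [pow_one]
    refine (norm_le_abs_re_add_abs_im s).trans ?_
    rw [abs_of_pos hs₁]
    linarith [le_abs_self b]
  have h3 := le_norm_Gamma_half_add s.im
  have h4 : ‖(Gamma s)⁻¹‖ * Real.exp (-(Real.pi / 2) * |s.im|)
      ≤ ‖s‖ * Real.Gamma (1 / 2) * (Real.Gamma (s.re + 1))⁻¹ := by
    rw [norm_inv, ← div_eq_mul_inv, le_div_iff₀ hGr]
    calc _ = ‖Gamma s‖⁻¹ * (Real.exp (-(Real.pi / 2) * |s.im|) * Real.Gamma (s.re + 1)) := by ring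
      _ ≤ ‖Gamma s‖⁻¹ * (‖s‖ * ‖Gamma s‖ * Real.Gamma (1 / 2)) := by
        exact mul_le_mul_of_nonneg_left
          ((mul_le_mul_of_nonneg_right h3 hGr.le).trans hmono) (by positivity)
      _ = _ := by field_simp
  have h5 : ‖(Gamma s)⁻¹‖ * Real.exp (-(Real.pi / 2) * |s.im|)
      ≤ (C₂ * Real.exp (ε * |s.im|)) * Real.Gamma (1 / 2) * (|C₁| + 1) := h4.trans (by gcongr)
  rw [← le_div_iff₀ (Real.exp_pos _), div_eq_mul_inv, ← Real.exp_neg] at h5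
  refine h5.trans_eq ?_
  rw [show (Real.pi / 2 + ε) * |s.im| = ε * |s.im| + -(-(Real.pi / 2) * |s.im|) by ring,
    Real.exp_add]
  ring

theorem norm_GammaR_le {c k : ℝ} {s : ℂ} (hs : 0 ≤ s.re)
    (h : ‖Gamma (s / 2)‖ ≤ c * Real.exp (-k * |(s / 2).im|)) :
    ‖GammaR s‖ ≤ c * Real.exp (-k / 2 * |s.im|) := by
  have hpi : ‖(Real.pi : ℂ) ^ (-s / 2)‖ ≤ 1 := by
    rw [norm_cpow_eq_rpow_re_of_pos Real.pi_pos]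
    refine Real.rpow_le_one_of_one_le_of_nonpos (by linarith [Real.pi_gt_three]) ?_
    simp
    linarith
  rw [GammaR, norm_mul]
  refine (mul_le_of_le_one_left (norm_nonneg _) hpi).trans (h.trans_eq ?_)
  rw [div_ofNat_im, abs_div, abs_two]
  ring_nf

theorem norm_GammaR_inv_le {c k b : ℝ} {s : ℂ} (hs : s.re ≤ 2 * b)
    (h : ‖(Gamma (s / 2))⁻¹‖ ≤ c * Real.exp (k * |(s / 2).im|)) :
    ‖(GammaR s)⁻¹‖ ≤ Real.pi ^ b * c * Real.exp (k / 2 * |s.im|) := by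
  have hpi : ‖((Real.pi : ℂ) ^ (-s / 2))⁻¹‖ ≤ Real.pi ^ b := by
    rw [norm_inv, norm_cpow_eq_rpow_re_of_pos Real.pi_pos, ← Real.rpow_neg Real.pi_pos.le]
    refine Real.rpow_le_rpow_of_exponent_le (by linarith [Real.pi_gt_three]) ?_
    simp
    linarith
  rw [GammaR, mul_inv, norm_mul, mul_assoc]
  refine mul_le_mul hpi (h.trans_eq ?_) (norm_nonneg _) (by positivity)
  rw [div_ofNat_im, abs_div, abs_two]
  ring_nf

/-- The combination of the Stirling exponents of all Gamma factors of the kernel. -/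
theorem stirling_exponent_le {q ε T A a₁ a₂ a₃ τ v t t₁ : ℝ} (hε : 0 < ε) (hq : 7 * ε ≤ q)
    (hA : |a₁| + |a₂| + |a₃| ≤ A) (ht : |t| ≤ T) :
    -q / 2 * |τ - v + a₁| + -q / 2 * |t₁ - a₁| + (-q / 2 * |τ - v + a₂| + -q / 2 * |t₁ - a₂|) +
      (-q / 2 * |τ - v + a₃| + -q / 2 * |t₁ - a₃|) + (q + 2 * ε) / 2 * |τ - v + t₁| +
      (q - 7 * ε) * |v| + -q * |v| + -q / 2 * |v - 2 * t + t₁ - τ| +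
      -q / 2 * |2 * t - τ - v| + (q + 2 * ε) * |t₁ / 2 - τ|
    ≤ q * (A + 2 * T) + (-(2 * ε) * |τ| + -(2 * ε) * |v| + -(2 * ε) * |t₁|) := by
  have hX (a : ℝ) : |τ - v| - |a| ≤ |τ - v + a| := by
    have := abs_sub_abs_le_abs_sub (τ - v) (-a)
    rwa [abs_neg, sub_neg_eq_add] at this
  have hY (a : ℝ) : |t₁| - |a| ≤ |t₁ - a| := abs_sub_abs_le_abs_sub _ _
  have hZ : |τ - v + t₁| ≤ |τ - v| + |t₁| := abs_add_le _ _
  have hM : |t₁ / 2 - τ| ≤ (|v - 2 * t + t₁ - τ| + |2 * t - τ - v|) / 2 + 2 * T := by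
    have h := abs_add_le (v - 2 * t + t₁ - τ) (2 * t - τ - v)
    rw [show v - 2 * t + t₁ - τ + (2 * t - τ - v) = 2 * (t₁ / 2 - τ) by ring, abs_mul,
      abs_two] at h
    linarith [abs_nonneg t]
  have hτ : |τ| ≤ |τ - v| + |v| := by
    simpa using abs_add_le (τ - v) v
  have hM' : |t₁ / 2 - τ| ≤ |t₁| / 2 + (|τ - v| + |v|) := by
    have h := abs_sub (t₁ / 2) τ
    rw [abs_div, abs_two] at h
    linarith
  have hq0 : 0 ≤ q := by linarith
  have b1 := mul_le_mul_of_nonneg_left (show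
    -(|τ - v + a₁| + |t₁ - a₁| + |τ - v + a₂| + |t₁ - a₂| + |τ - v + a₃| + |t₁ - a₃|) / 2
      + |τ - v + t₁| / 2 - |v - 2 * t + t₁ - τ| / 2 - |2 * t - τ - v| / 2 + |t₁ / 2 - τ|
      ≤ -|τ - v| - |t₁| + (A + 2 * T) by
    linarith [hX a₁, hX a₂, hX a₃, hY a₁, hY a₂, hY a₃]) hq0
  have b2 := mul_le_mul_of_nonneg_left (show
    |τ - v + t₁| - 7 * |v| + 2 * |t₁ / 2 - τ| ≤ 3 * |τ - v| + 2 * |t₁| - 5 * |v| by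
    linarith) hε.le
  have b3 := mul_le_mul_of_nonneg_right hq (abs_nonneg (τ - v))
  have b4 := mul_le_mul_of_nonneg_right hq (abs_nonneg t₁)
  have b5 := mul_le_mul_of_nonneg_left hτ hε.le
  have b6 := mul_nonneg hε.le (abs_nonneg (τ - v))
  have b7 := mul_nonneg hε.le (abs_nonneg t₁)
  have b8 := mul_nonneg hε.le (abs_nonneg v)
  linarith

theorem exists_norm_GkerPhi_le {α : Fin 3 → ℂ} (hre : ∀ i, (α i).re = 0) {δ : ℝ}
    (hδ : δ = 1 ∨ δ = -1) {φ ε : ℝ} (hφ₁ : 0 < φ) (hε : 0 < ε) (hφε : Real.pi / 2 = φ + 8 * ε)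
    {a : ℝ} (ha : 0 < a) (T : ℝ) :
    ∃ C : ℝ, 0 < C ∧ ∀ s1 u s0 s : ℂ, s1.re = 15 → a ≤ u.re → u.re ≤ 1 → a ≤ (s0 - u).re →
      s0.re < 8 → a ≤ (2 * s - s0 - u).re → s.re < 4 → a ≤ (u + 1 - 2 * s + s1 - s0).re →
      |s.im| ≤ T →
      ‖GkerPhi α δ φ s1 u s0 s‖ ≤ C * (Real.exp (-(2 * ε) * |s0.im|) *
        Real.exp (-(2 * ε) * |u.im|) * Real.exp (-(2 * ε) * |s1.im|)) := by
  obtain ⟨c, hc, hup⟩ := exists_norm_Gamma_le (a := a / 2) (b := 20) (half_pos ha) hε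
  obtain ⟨d, hd, hlow⟩ := exists_norm_Gamma_inv_le (b := 20) hε
  set q := Real.pi / 2 - ε with hq
  set A := |(α 0).im| + |(α 1).im| + |(α 2).im| with hA
  refine ⟨c ^ 9 * (Real.pi ^ (20 : ℝ) * d) * d * Real.exp (q * (A + 2 * T)), by positivity, ?_⟩
  intro s1 u s0 s hs1 hu hu1 hs0u hs0 hsu hs hus ht
  simp only [sub_re, add_re, mul_re, one_re, re_ofNat, im_ofNat, zero_mul, sub_zero]
    at hs0u hsu hus
  have hR (z : ℂ) (h1 : a ≤ z.re) (h2 : z.re ≤ 40) :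
      ‖GammaR z‖ ≤ c * Real.exp (-q / 2 * |z.im|) :=
    norm_GammaR_le (by linarith) (hup _ (by simp; linarith) (by simp; linarith))
  have g1 (i : Fin 3) : ‖GammaR (s0 - u + α i)‖
      ≤ c * Real.exp (-q / 2 * |s0.im - u.im + (α i).im|) := by
    simpa using hR (s0 - u + α i) (by simp [hre]; linarith) (by simp [hre]; linarith)
  have g2 (i : Fin 3) : ‖GammaR (s1 - α i)‖ ≤ c * Real.exp (-q / 2 * |s1.im - (α i).im|) := by
    simpa using hR (s1 - α i) (by simp [hre]; linarith) (by simp [hre]; linarith)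
  have g3 : ‖(GammaR (s0 - u + s1))⁻¹‖ ≤ Real.pi ^ (20 : ℝ) * d *
      Real.exp ((q + 2 * ε) / 2 * |s0.im - u.im + s1.im|) := by
    have := norm_GammaR_inv_le (s := s0 - u + s1) (b := 20) (by simp; linarith)
      (hlow _ (by simp; linarith) (by simp; linarith))
    rw [show q + 2 * ε = Real.pi / 2 + ε by rw [hq]; ring]
    simpa using this
  have g4 : ‖(2 * (Real.pi : ℂ)) ^ (-u)‖ ≤ 1 := by
    rw [show (2 * (Real.pi : ℂ)) = ((2 * Real.pi : ℝ) : ℂ) by push_cast; rfl,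
      norm_cpow_eq_rpow_re_of_pos Real.two_pi_pos]
    refine Real.rpow_le_one_of_one_le_of_nonpos (by linarith [Real.pi_gt_three]) ?_
    simp
    linarith
  have g5 : ‖exp (I * δ * φ * u)‖ ≤ Real.exp ((q - 7 * ε) * |u.im|) := by
    rw [norm_exp, Real.exp_le_exp, show q - 7 * ε = φ by rw [hq]; linarith]
    have : (I * δ * φ * u).re = φ * (-(δ * u.im)) := by simp; ring
    rw [this]
    refine mul_le_mul_of_nonneg_left ?_ hφ₁.le
    rcases hδ with rfl | rfl
    · simpa using neg_le_abs u.im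
    · simpa using le_abs_self u.im
  have g6 : ‖Gamma u‖ ≤ c * Real.exp (-q * |u.im|) := hup u (by linarith) (by linarith)
  have g7 : ‖Gamma ((u + 1 - 2 * s + s1 - s0) / 2)‖
      ≤ c * Real.exp (-q / 2 * |u.im - 2 * s.im + s1.im - s0.im|) := by
    have := hup ((u + 1 - 2 * s + s1 - s0) / 2) (by simp; linarith) (by simp; linarith)
    simp [abs_div] at this
    convert this using 3
    ring
  have g8 : ‖Gamma ((2 * s - s0 - u) / 2)‖
      ≤ c * Real.exp (-q / 2 * |2 * s.im - s0.im - u.im|) := by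
    have := hup ((2 * s - s0 - u) / 2) (by simp; linarith) (by simp; linarith)
    simp [abs_div] at this
    convert this using 3
    ring
  have g9 : ‖(Gamma ((1 + s1) / 2 - s0))⁻¹‖
      ≤ d * Real.exp ((q + 2 * ε) * |s1.im / 2 - s0.im|) := by
    rw [show q + 2 * ε = Real.pi / 2 + ε by rw [hq]; ring]
    simpa using hlow ((1 + s1) / 2 - s0) (by simp; linarith) (by simp; linarith)
  have hexp := Real.exp_le_exp.mpr (stirling_exponent_le (q := q) (τ := s0.im) (v := u.im)
    (t₁ := s1.im) hε (by rw [hq]; linarith) hA.ge ht)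
  simp only [Real.exp_add] at hexp
  have hdecomp : GkerPhi α δ φ s1 u s0 s =
      (GammaR (s0 - u + α 0) * GammaR (s1 - α 0)) * (GammaR (s0 - u + α 1) * GammaR (s1 - α 1)) *
      (GammaR (s0 - u + α 2) * GammaR (s1 - α 2)) * (GammaR (s0 - u + s1))⁻¹ *
      (2 * (Real.pi : ℂ)) ^ (-u) * exp (I * δ * φ * u) * Gamma u *
      Gamma ((u + 1 - 2 * s + s1 - s0) / 2) * Gamma ((2 * s - s0 - u) / 2) *
      (Gamma ((1 + s1) / 2 - s0))⁻¹ := by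
    rw [GkerPhi, Gfun, Fin.prod_univ_three, div_eq_mul_inv, div_eq_mul_inv]
  rw [hdecomp]
  simp only [norm_mul]
  calc _ ≤ c * Real.exp (-q / 2 * |s0.im - u.im + (α 0).im|) *
          (c * Real.exp (-q / 2 * |s1.im - (α 0).im|)) *
          (c * Real.exp (-q / 2 * |s0.im - u.im + (α 1).im|) *
          (c * Real.exp (-q / 2 * |s1.im - (α 1).im|))) *
          (c * Real.exp (-q / 2 * |s0.im - u.im + (α 2).im|) *
          (c * Real.exp (-q / 2 * |s1.im - (α 2).im|))) *
          (Real.pi ^ (20 : ℝ) * d * Real.exp ((q + 2 * ε) / 2 * |s0.im - u.im + s1.im|)) * 1 *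
          Real.exp ((q - 7 * ε) * |u.im|) * (c * Real.exp (-q * |u.im|)) *
          (c * Real.exp (-q / 2 * |u.im - 2 * s.im + s1.im - s0.im|)) *
          (c * Real.exp (-q / 2 * |2 * s.im - s0.im - u.im|)) *
          (d * Real.exp ((q + 2 * ε) * |s1.im / 2 - s0.im|)) := by
        gcongr
        · exact g1 0
        · exact g2 0
        · exact g1 1
        · exact g2 1
        · exact g1 2
        · exact g2 2
    _ ≤ _ := by
        refine le_trans (le_of_eq ?_) ((mul_le_mul_of_nonneg_left hexp
          (show 0 ≤ c ^ 9 * (Real.pi ^ (20 : ℝ) * d) * d by positivity)).trans_eq ?_)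
        · ring
        · ring

theorem differentiableAt_Gamma_of_re_pos {s : ℂ} (hs : 0 < s.re) : DifferentiableAt ℂ Gamma s :=
  differentiableAt_Gamma s fun m h => by
    have := congrArg re h
    simp only [neg_re, natCast_re] at this
    linarith [(Nat.cast_nonneg m : (0 : ℝ) ≤ m)]

theorem differentiableAt_GammaR {s : ℂ} (hs : 0 < s.re) : DifferentiableAt ℂ GammaR s := by
  have hpi : (Real.pi : ℂ) ≠ 0 := ofReal_ne_zero.mpr Real.pi_ne_zero
  have hG : DifferentiableAt ℂ Gamma (s / 2) := differentiableAt_Gamma_of_re_pos (by simpa using hs)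
  unfold GammaR
  exact ((by fun_prop : DifferentiableAt ℂ (fun s : ℂ => -s / 2) s).const_cpow (.inl hpi)).mul
    (hG.comp s (by fun_prop : DifferentiableAt ℂ (fun s : ℂ => s / 2) s))

theorem GammaR_ne_zero {s : ℂ} (hs : 0 < s.re) : GammaR s ≠ 0 :=
  mul_ne_zero (by simp [cpow_eq_zero_iff, Real.pi_ne_zero])
    (Gamma_ne_zero_of_re_pos (by simpa using hs))

theorem differentiableAt_GkerPhi {α : Fin 3 → ℂ} (hre : ∀ i, (α i).re = 0) (δ φ : ℝ)
    {s1 u s0 s : ℂ} (hs1 : 0 < s1.re) (hu : 0 < u.re) (hs0u : 0 < (s0 - u).re)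
    (hus : 0 < (u + 1 - 2 * s + s1 - s0).re) (hsu : 0 < (2 * s - s0 - u).re) :
    DifferentiableAt ℂ (fun u => GkerPhi α δ φ s1 u s0 s) u := by
  have h2pi : (2 * (Real.pi : ℂ)) ≠ 0 :=
    mul_ne_zero two_ne_zero (ofReal_ne_zero.mpr Real.pi_ne_zero)
  have hG (i : Fin 3) : DifferentiableAt ℂ (fun u => GammaR (s0 - u + α i)) u :=
    (differentiableAt_GammaR (by rw [add_re, hre, add_zero]; exact hs0u)).comp u
      (by fun_prop : DifferentiableAt ℂ (fun u => s0 - u + α i) u)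
  have hsum : 0 < (s0 - u + s1).re := by rw [add_re]; linarith
  have hD : DifferentiableAt ℂ (fun u => GammaR (s0 - u + s1)) u :=
    (differentiableAt_GammaR hsum).comp (f := fun u => s0 - u + s1) u (by fun_prop)
  have hprod : DifferentiableAt ℂ (fun u => Gfun α (s0 - u) s1) u := by
    simp only [Gfun, Fin.prod_univ_three]
    exact (((((hG 0).mul_const _).mul ((hG 1).mul_const _)).mul ((hG 2).mul_const _))).div hD
      (GammaR_ne_zero hsum)
  have hpow : DifferentiableAt ℂ (fun u : ℂ => (2 * (Real.pi : ℂ)) ^ (-u)) u :=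
    (by fun_prop : DifferentiableAt ℂ (fun u : ℂ => -u) u).const_cpow (.inl h2pi)
  have hexp : DifferentiableAt ℂ (fun u : ℂ => exp (I * δ * φ * u)) u := by fun_prop
  have h1 : DifferentiableAt ℂ (fun u => Gamma ((u + 1 - 2 * s + s1 - s0) / 2)) u :=
    (differentiableAt_Gamma_of_re_pos (by simpa using hus)).comp u
      (by fun_prop : DifferentiableAt ℂ (fun u => (u + 1 - 2 * s + s1 - s0) / 2) u)
  have h2 : DifferentiableAt ℂ (fun u => Gamma ((2 * s - s0 - u) / 2)) u :=
    (differentiableAt_Gamma_of_re_pos (by simpa using hsu)).comp u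
      (by fun_prop : DifferentiableAt ℂ (fun u => (2 * s - s0 - u) / 2) u)
  unfold GkerPhi
  exact (((((hprod.mul hpow).mul hexp).mul (differentiableAt_Gamma_of_re_pos hu)).mul h1).mul
    h2).div_const _

/-- The `u`-contour can be moved away from the poles of the kernel. -/
theorem integral_GkerPhi_shift {α : Fin 3 → ℂ} (hre : ∀ i, (α i).re = 0) {δ : ℝ}
    (hδ : δ = 1 ∨ δ = -1) {φ : ℝ} (hφ₁ : 0 < φ) (hφ₂ : φ < Real.pi / 2) {s1 s0 s : ℂ}
    (hs1 : s1.re = 15) (hs0 : 1 / 100 < s0.re) (hs : s.re < 4)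
    (hss0 : 0 < 2 * s.re - s0.re - 1 / 100) :
    ∫ v : ℝ, GkerPhi α δ φ s1 (1 / 100 + v * I) s0 s
      = ∫ v : ℝ, GkerPhi α δ φ s1 (1 / 200 + v * I) s0 s := by
  set ε := (Real.pi / 2 - φ) / 8 with hε
  have hε0 : 0 < ε := by rw [hε]; linarith
  obtain ⟨a, ha0, ha1, ha2, ha3⟩ : ∃ a : ℝ, 0 < a ∧ a ≤ 1 / 200 ∧ a ≤ s0.re - 1 / 100 ∧
      a ≤ 2 * s.re - s0.re - 1 / 100 :=
    ⟨min (1 / 200) (min (s0.re - 1 / 100) (2 * s.re - s0.re - 1 / 100)),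
      lt_min (by norm_num) (lt_min (by linarith) hss0), min_le_left _ _,
      (min_le_right _ _).trans (min_le_left _ _), (min_le_right _ _).trans (min_le_right _ _)⟩
  obtain ⟨C, hC, hbound⟩ := exists_norm_GkerPhi_le hre hδ hφ₁ hε0
    (by rw [hε]; ring) ha0 |s.im|
  have hmem (z : ℂ) (hz : z.re ∈ uIcc (1 / 100 : ℝ) (1 / 200)) :
      1 / 200 ≤ z.re ∧ z.re ≤ 1 / 100 := by
    rwa [uIcc_of_ge (by norm_num)] at hz
  have h := integral_vertical_eq (f := fun u => GkerPhi α δ φ s1 u s0 s) (a := 1 / 100)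
    (b := 1 / 200) (B := C) (c := 2 * ε) (by linarith) ?_ ?_
  · push_cast at h
    exact h
  · intro u hu
    obtain ⟨h1, h2⟩ := hmem u hu
    refine (differentiableAt_GkerPhi hre δ φ ?_ ?_ ?_ ?_ ?_).differentiableWithinAt <;>
      first | linarith | (simp; linarith)
  · intro u hu
    obtain ⟨h1, h2⟩ := hmem u hu
    refine (hbound s1 u s0 s hs1 (by linarith) (by linarith) (by simp; linarith) (by linarith)
      (by simp; linarith) hs (by simp; linarith) le_rfl).trans ?_
    have e1 : Real.exp (-(2 * ε) * |s0.im|) ≤ 1 := Real.exp_le_one_iff.mpr (by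
      have := mul_nonneg hε0.le (abs_nonneg s0.im); linarith)
    have e2 : Real.exp (-(2 * ε) * |s1.im|) ≤ 1 := Real.exp_le_one_iff.mpr (by
      have := mul_nonneg hε0.le (abs_nonneg s1.im); linarith)
    refine mul_le_mul_of_nonneg_left ?_ hC.le
    calc _ ≤ 1 * Real.exp (-(2 * ε) * |u.im|) * 1 := by gcongr
      _ = _ := by ring

theorem exists_exp_neg_mul_le_rpow {c : ℝ} (hc : 0 < c) (N : ℝ) :
    ∃ C : ℝ, 0 < C ∧ ∀ x : ℝ, 0 ≤ x → Real.exp (-c * x) ≤ C * (1 + x) ^ (-N) := by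
  obtain ⟨m, hm⟩ := exists_nat_ge N
  obtain ⟨C, hC, h⟩ := exists_add_pow_le_exp 1 zero_le_one m hc
  refine ⟨C, hC, fun x hx => ?_⟩
  have h1 : (1 + x) ^ N ≤ C * Real.exp (c * x) := by
    refine le_trans ?_ (h x hx)
    rw [← Real.rpow_natCast]
    exact Real.rpow_le_rpow_of_exponent_le (by linarith) hm
  rw [Real.rpow_neg (by linarith), neg_mul, Real.exp_neg, ← div_eq_mul_inv,
    le_div_iff₀ (Real.rpow_pos_of_pos (by linarith) _), inv_mul_le_iff₀ (Real.exp_pos _)]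
  linarith

theorem inv_Gamma_mul_Gamma_neg (z : ℂ) :
    (Gamma z * Gamma (-z))⁻¹ = -(z * sin (Real.pi * z)) / Real.pi := by
  by_cases hz : z = 0
  · simp [hz]
  have h := Gamma_mul_Gamma_one_sub z
  rw [show 1 - z = -z + 1 by ring, Gamma_add_one _ (neg_ne_zero.mpr hz)] at h
  have h' : Gamma z * Gamma (-z) = -(Real.pi / sin (Real.pi * z) / z) := by
    rw [← h]
    field_simp
  rw [h', div_div, inv_neg, inv_div]
  ring

theorem norm_sin_le_exp (z : ℂ) : ‖sin z‖ ≤ Real.exp |z.im| := by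
  have h : ‖sin z‖ ≤ (‖exp (-z * I)‖ + ‖exp (z * I)‖) / 2 := by
    rw [Complex.sin, norm_div, norm_mul, norm_I, mul_one, Complex.norm_two]
    gcongr
    exact norm_sub_le _ _
  refine h.trans ?_
  rw [norm_exp, norm_exp]
  have h1 : Real.exp (-z * I).re ≤ Real.exp |z.im| :=
    Real.exp_le_exp.mpr (by simpa using le_abs_self z.im)
  have h2 : Real.exp (z * I).re ≤ Real.exp |z.im| :=
    Real.exp_le_exp.mpr (by simpa using neg_le_abs z.im)
  linarith

theorem integrable_exp_neg_mul_cosh {x : ℝ} (hx : 0 < x) :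
    Integrable fun r : ℝ => Real.exp (-x * Real.cosh r) := by
  refine (integrable_exp_neg_mul_abs (half_pos hx)).mono'
    (Continuous.aestronglyMeasurable (by fun_prop)) (.of_forall fun r => ?_)
  rw [Real.norm_eq_abs, Real.abs_exp, Real.exp_le_exp]
  have h1 := Real.exp_abs_le_two_mul_cosh r
  have h2 := Real.add_one_le_exp |r|
  nlinarith

theorem two_mul_KBessel (t : ℝ) {x : ℝ} (hx : 0 < x) :
    2 * KBessel (t * I) x
      = ∫ r : ℝ, (Real.exp (-x * Real.cosh r) : ℂ) * exp (t * r * I) := by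
  set f : ℝ → ℂ := fun r => (Real.exp (-x * Real.cosh r) : ℂ) * exp (t * r * I) with hf
  have hInt : Integrable f := by
    refine (integrable_exp_neg_mul_cosh hx).mono'
      (Continuous.aestronglyMeasurable (by fun_prop)) (.of_forall fun r => ?_)
    rw [hf, norm_mul, norm_real, Real.norm_eq_abs, Real.abs_exp, ← ofReal_mul,
      norm_exp_ofReal_mul_I, mul_one]
  have hneg : ∫ r in Ioi (0 : ℝ), f (-r) = ∫ r in Iic (0 : ℝ), f r := by
    simp
  have hsplit : ∫ r, f r = ∫ r in Ioi (0 : ℝ), (f (-r) + f r) := by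
    rw [integral_add hInt.comp_neg.integrableOn hInt.integrableOn, hneg,
      intervalIntegral.integral_Iic_add_Ioi hInt.integrableOn hInt.integrableOn]
  rw [hsplit, KBessel, ← integral_const_mul]
  refine setIntegral_congr_fun measurableSet_Ioi fun r _ => ?_
  simp only [hf, Real.cosh_neg, Complex.cosh]
  push_cast
  rw [show t * I * (r : ℂ) = t * r * I by ring, show t * -(r : ℂ) * I = -(t * r * I) by ring]
  ring

/-- The Taylor remainder of `exp` on the negative half-line. -/
theorem abs_exp_neg_sub_sum_le (n : ℕ) {z : ℝ} (hz : 0 ≤ z) :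
    |Real.exp (-z) - ∑ k ∈ Finset.range n, (-z) ^ k / k.factorial| ≤ (n + 3) * z ^ n := by
  rcases le_total z 1 with h1 | h1
  · have h := norm_exp_sub_sum_le_norm_mul_exp ((-z : ℝ) : ℂ) n
    have hcast : exp ((-z : ℝ) : ℂ) - ∑ m ∈ Finset.range n, ((-z : ℝ) : ℂ) ^ m / m.factorial
        = ((Real.exp (-z) - ∑ k ∈ Finset.range n, (-z) ^ k / k.factorial : ℝ) : ℂ) := by
      push_cast
      rfl
    rw [hcast, norm_real, norm_real, Real.norm_eq_abs, Real.norm_eq_abs, abs_neg,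
      abs_of_nonneg hz] at h
    refine h.trans ?_
    have he : Real.exp z ≤ n + 3 := by
      have := Real.exp_le_exp.mpr h1
      linarith [Real.exp_one_lt_d9, (Nat.cast_nonneg n : (0 : ℝ) ≤ n)]
    rw [mul_comm]
    gcongr
  · have hsum : |∑ k ∈ Finset.range n, (-z) ^ k / k.factorial| ≤ n * z ^ n := by
      refine (Finset.abs_sum_le_sum_abs _ _).trans ?_
      have : ∀ k ∈ Finset.range n, |(-z) ^ k / k.factorial| ≤ z ^ n := by
        intro k hk
        rw [abs_div, abs_pow, abs_neg, abs_of_nonneg hz, Nat.abs_cast]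
        refine (div_le_self (by positivity) ?_).trans
          (pow_le_pow_right₀ h1 (Finset.mem_range.mp hk).le)
        exact_mod_cast Nat.one_le_iff_ne_zero.mpr k.factorial_ne_zero
      simpa using Finset.sum_le_sum this
    have hexp : |Real.exp (-z)| ≤ 1 := by
      rw [Real.abs_exp, Real.exp_le_one_iff]
      linarith
    have := one_le_pow₀ h1 (n := n)
    calc _ ≤ _ := abs_sub _ _
      _ ≤ 1 + n * z ^ n := add_le_add hexp hsum
      _ ≤ _ := by linarith

/-- A function holomorphic on a closed strip around the imaginary axis, with exponential decay. -/
structure StripDecay (F : ℂ → ℂ) (A B : ℝ) : Prop where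
  differentiableOn : DifferentiableOn ℂ F {z | |z.re| ≤ A}
  norm_le : ∀ z : ℂ, |z.re| ≤ A → ‖F z‖ ≤ B * Real.exp (-1 * |z.im|)

/-- The Fourier integral of `F` along the imaginary axis. -/
noncomputable def axisFourier (F : ℂ → ℂ) (r : ℝ) : ℂ :=
  ∫ t : ℝ, F (t * I) * exp (t * r * I)

namespace StripDecay

variable {F : ℂ → ℂ} {A B : ℝ}

theorem integrable (hF : StripDecay F A B) {a : ℝ} (ha : |a| ≤ A) :
    Integrable fun t : ℝ => F (a + t * I) :=
  integrable_vertical (S := {a | |a| ≤ A}) one_pos ha hF.differentiableOn.continuousOn hF.norm_le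

theorem continuous (hF : StripDecay F A B) {a : ℝ} (ha : |a| ≤ A) :
    Continuous fun t : ℝ => F (a + t * I) :=
  hF.differentiableOn.continuousOn.comp_continuous (by fun_prop) fun t => by simpa using ha

theorem axisFourier_shift (hF : StripDecay F A B) {a : ℝ} (ha : |a| ≤ A) (r : ℝ) :
    axisFourier F r = exp (a * r) * ∫ t : ℝ, F (a + t * I) * exp (t * r * I) := by
  have hsub (z : ℂ) (hz : z.re ∈ uIcc 0 a) : |z.re| ≤ A := by
    refine le_trans ?_ ha
    simpa using abs_sub_left_of_mem_uIcc hz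
  have hB : 0 ≤ B := by
    have := (norm_nonneg _).trans (hF.norm_le a (by simpa using ha))
    simpa using this
  have h := integral_vertical_eq (f := fun z => F z * exp (z * r)) (a := 0) (b := a)
    (B := B * Real.exp (A * |r|)) one_pos ?_ ?_
  · rw [axisFourier, ← integral_const_mul]
    refine Eq.trans (integral_congr_ae (.of_forall fun t => ?_))
      (h.trans (integral_congr_ae (.of_forall fun t => ?_)))
    · simp only [ofReal_zero, zero_add]
      ring_nf
    · simp only [add_mul, exp_add]
      ring_nf
  · exact (hF.differentiableOn.mono hsub).mul (by fun_prop)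
  · intro z hz
    rw [norm_mul, norm_exp]
    have h1 : (z * r).re ≤ A * |r| := by
      rw [re_mul_ofReal]
      refine (le_abs_self _).trans ?_
      rw [abs_mul]
      exact mul_le_mul_of_nonneg_right (hsub z hz) (abs_nonneg _)
    calc _ ≤ (B * Real.exp (-1 * |z.im|)) * Real.exp (A * |r|) := by
          gcongr
          exact hF.norm_le z (hsub z hz)
      _ = _ := by ring

theorem norm_axisFourier_le (hF : StripDecay F A B) (hA : 0 ≤ A) :
    ∃ C : ℝ, 0 < C ∧ ∀ r : ℝ, ‖axisFourier F r‖ ≤ C * Real.exp (-A * |r|) := by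
  have key (a : ℝ) (ha : |a| ≤ A) (r : ℝ) :
      ‖axisFourier F r‖ ≤ (∫ t : ℝ, ‖F (a + t * I)‖) * Real.exp (a * r) := by
    rw [hF.axisFourier_shift ha, norm_mul, norm_exp, ← ofReal_mul, ofReal_re, mul_comm]
    gcongr
    refine (norm_integral_le_integral_norm _).trans_eq ?_
    congr 1
    ext t
    rw [norm_mul, ← ofReal_mul, norm_exp_ofReal_mul_I, mul_one]
  set C₁ := ∫ t : ℝ, ‖F ((A : ℝ) + t * I)‖
  set C₂ := ∫ t : ℝ, ‖F ((-A : ℝ) + t * I)‖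
  have h₁ : 0 ≤ C₁ := integral_nonneg fun t => norm_nonneg _
  have h₂ : 0 ≤ C₂ := integral_nonneg fun t => norm_nonneg _
  refine ⟨C₁ + C₂ + 1, by linarith, fun r => ?_⟩
  rcases le_total 0 r with hr | hr
  · rw [abs_of_nonneg hr]
    refine (key (-A) (by simp [abs_of_nonneg hA]) r).trans ?_
    gcongr
    linarith
  · rw [abs_of_nonpos hr, neg_mul_neg]
    refine (key A (by simp [abs_of_nonneg hA]) r).trans ?_
    gcongr
    linarith

theorem continuous_axisFourier (hF : StripDecay F A B) (hA : 0 ≤ A) :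
    Continuous (axisFourier F) := by
  have h0 : |(0 : ℝ)| ≤ A := by simpa using hA
  have hi : Integrable fun t : ℝ => F (t * I) := by simpa using hF.integrable h0
  have hc : Continuous fun t : ℝ => F (t * I) := by simpa using hF.continuous h0
  refine continuous_of_dominated (fun r => ?_) (fun r => .of_forall fun t => ?_) hi.norm
    (.of_forall fun t => by fun_prop)
  · exact (hc.mul (by fun_prop)).aestronglyMeasurable
  · rw [norm_mul, ← ofReal_mul, norm_exp_ofReal_mul_I, mul_one]

theorem integrable_mul_axisFourier (hF : StripDecay F A B) (hA : 0 ≤ A) {p : ℝ → ℝ} {a : ℝ}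
    (haA : a < A) (hp : Continuous p) (hpa : ∀ r, |p r| ≤ Real.exp (a * |r|)) :
    Integrable fun r : ℝ => (p r : ℂ) * axisFourier F r := by
  obtain ⟨C, hC, hbound⟩ := hF.norm_axisFourier_le hA
  refine ((integrable_exp_neg_mul_abs (sub_pos.mpr haA)).const_mul C).mono'
    (((continuous_ofReal.comp hp).mul
      (hF.continuous_axisFourier hA)).aestronglyMeasurable) (.of_forall fun r => ?_)
  rw [norm_mul, norm_real, Real.norm_eq_abs]
  calc _ ≤ Real.exp (a * |r|) * (C * Real.exp (-A * |r|)) := by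
        gcongr
        · exact hpa r
        · exact hbound r
    _ = _ := by
        rw [show -(A - a) * |r| = a * |r| + -A * |r| by ring, Real.exp_add]
        ring

/-- The exponential moment of order `-a` of the Fourier integral vanishes when `F a = 0`. -/
theorem integral_exp_mul_axisFourier_eq_zero (hF : StripDecay F A B) (hA : 0 ≤ A) {a : ℝ}
    (ha : |a| < A) (hzero : F a = 0) :
    ∫ r : ℝ, (Real.exp (-a * r) : ℂ) * axisFourier F r = 0 := by
  set f : ℝ → ℂ := fun t => F (a + t * I)
  have hf : Integrable f := hF.integrable ha.le
  have hfc : Continuous f := hF.continuous ha.le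
  have hinv (w : ℝ) : FourierTransformInv.fourierInv f w
      = (Real.exp (-a * (2 * Real.pi * w)) : ℂ) * axisFourier F (2 * Real.pi * w) := by
    rw [hF.axisFourier_shift ha.le, ← mul_assoc, ofReal_exp, ← exp_add, Real.fourierInv_eq']
    have : ((-a * (2 * Real.pi * w) : ℝ) : ℂ) + a * ((2 * Real.pi * w : ℝ) : ℂ) = 0 := by
      push_cast
      ring
    rw [this, exp_zero, one_mul]
    refine integral_congr_ae (.of_forall fun t => ?_)
    simp only [smul_eq_mul, RCLike.inner_apply, conj_trivial, f]
    rw [mul_comm]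
    push_cast
    ring_nf
  have hg : Integrable fun r : ℝ => (Real.exp (-a * r) : ℂ) * axisFourier F r := by
    refine hF.integrable_mul_axisFourier hA ha (by fun_prop) fun r => ?_
    rw [Real.abs_exp, Real.exp_le_exp, neg_mul, ← abs_mul]
    exact neg_le_abs _
  have hfi : Integrable (FourierTransformInv.fourierInv f) := by
    have := hg.comp_mul_left' (R := 2 * Real.pi) Real.two_pi_pos.ne'
    refine this.congr (.of_forall fun w => (hinv w).symm)
  have hft : Integrable (FourierTransform.fourier f) := by
    have := hfi.comp_neg
    refine this.congr (.of_forall fun w => ?_)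
    simp [Real.fourierInv_eq_fourier_neg]
  have h := congrFun (hfc.fourier_fourierInv_eq hf hft) 0
  rw [Real.fourier_eq'] at h
  simp only [inner_zero_right, mul_zero, ofReal_zero, zero_mul, exp_zero, one_smul, f, add_zero,
    hzero] at h
  rw [integral_congr_ae (.of_forall hinv), Measure.integral_comp_mul_left
    (fun r : ℝ => (Real.exp (-a * r) : ℂ) * axisFourier F r)] at h
  exact (smul_eq_zero.mp h).resolve_left (by positivity)

theorem integral_cosh_pow_mul_axisFourier_eq_zero (hF : StripDecay F A B) {n : ℕ} (hn : n < A)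
    (hzero : ∀ j : ℤ, F j = 0) (k : ℕ) (hk : k ≤ n) :
    ∫ r : ℝ, ((Real.cosh r ^ k : ℝ) : ℂ) * axisFourier F r = 0 := by
  have hA : 0 ≤ A := (Nat.cast_nonneg n).trans hn.le
  have key (k : ℕ) : ∀ j : ℤ, k + |j| ≤ n →
      ∫ r : ℝ, ((Real.cosh r ^ k * Real.exp (-j * r) : ℝ) : ℂ) * axisFourier F r = 0 := by
    induction k with
    | zero =>
      intro j hj
      have hj' : |(j : ℝ)| ≤ n := by
        rw [← Int.cast_abs]
        exact_mod_cast (by simpa using hj : |j| ≤ n)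
      simpa using hF.integral_exp_mul_axisFourier_eq_zero hA (a := j) (hj'.trans_lt hn)
        (by simpa using hzero j)
    | succ k ih =>
      intro j hj
      have hbd (i : ℤ) (hi : |i - j| ≤ 1) : k + |i| ≤ n := by
        push_cast at hj
        have := abs_add_le (i - j) j
        rw [sub_add_cancel] at this
        linarith
      have hInt (i : ℤ) (hi : |i - j| ≤ 1) : Integrable fun r : ℝ =>
          ((Real.cosh r ^ k * Real.exp (-i * r) : ℝ) : ℂ) * axisFourier F r := by
        refine hF.integrable_mul_axisFourier hA hn (by fun_prop) fun r => ?_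
        rw [abs_mul, Real.abs_exp, abs_pow, abs_of_pos (Real.cosh_pos r)]
        have hi' : (k : ℝ) + |(i : ℝ)| ≤ n := by
          rw [← Int.cast_abs]
          exact_mod_cast hbd i hi
        calc _ ≤ Real.exp |r| ^ k * Real.exp (|(i : ℝ)| * |r|) := by
              refine mul_le_mul
                (pow_le_pow_left₀ (Real.cosh_pos r).le (Real.cosh_le_exp_abs r) k)
                (Real.exp_le_exp.mpr ?_) (Real.exp_pos _).le (by positivity)
              rw [neg_mul, ← abs_mul]
              exact neg_le_abs _
          _ = Real.exp ((k + |(i : ℝ)|) * |r|) := by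
              rw [← Real.exp_nat_mul, ← Real.exp_add]
              ring_nf
          _ ≤ _ := by gcongr
      have h1 := ih (j - 1) (hbd _ (by simp))
      have h2 := ih (j + 1) (hbd _ (by simp))
      have hadd := integral_add (hInt (j - 1) (by simp)) (hInt (j + 1) (by simp))
      rw [h1, h2, add_zero] at hadd
      have heq (r : ℝ) : ((Real.cosh r ^ (k + 1) * Real.exp (-j * r) : ℝ) : ℂ) * axisFourier F r
          = 1 / 2 * (((Real.cosh r ^ k * Real.exp (-(j - 1 : ℤ) * r) : ℝ) : ℂ) * axisFourier F r
            + ((Real.cosh r ^ k * Real.exp (-(j + 1 : ℤ) * r) : ℝ) : ℂ) * axisFourier F r) := by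
        have : Real.cosh r ^ (k + 1) * Real.exp (-j * r) = 1 / 2 * (
            Real.cosh r ^ k * Real.exp (-(j - 1 : ℤ) * r) +
            Real.cosh r ^ k * Real.exp (-(j + 1 : ℤ) * r)) := by
          rw [pow_succ, Real.cosh_eq]
          push_cast
          rw [show -((j : ℝ) - 1) * r = -j * r + r by ring,
            show -((j : ℝ) + 1) * r = -j * r + -r by ring, Real.exp_add, Real.exp_add]
          ring
        rw [this]
        push_cast
        ring
      rw [integral_congr_ae (.of_forall heq), integral_const_mul, hadd, mul_zero]
  simpa using key k 0 (by simpa using hk)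

/-- Vanishing moments make the Laplace-type integral against `exp (-x cosh r)` small at `0`. -/
theorem exists_norm_integral_exp_cosh_le (hF : StripDecay F A B) {n : ℕ} (hn : n < A)
    (hzero : ∀ j : ℤ, F j = 0) :
    ∃ C : ℝ, 0 < C ∧ ∀ x : ℝ, 0 < x →
      ‖∫ r : ℝ, (Real.exp (-x * Real.cosh r) : ℂ) * axisFourier F r‖ ≤ C * x ^ n := by
  have hA : 0 ≤ A := (Nat.cast_nonneg n).trans hn.le
  have hpow (k : ℕ) (hk : k ≤ n) :
      Integrable fun r : ℝ => ((Real.cosh r ^ k : ℝ) : ℂ) * axisFourier F r := by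
    refine hF.integrable_mul_axisFourier hA hn (by fun_prop) fun r => ?_
    rw [abs_pow, abs_of_pos (Real.cosh_pos r), Real.exp_nat_mul]
    calc _ ≤ Real.exp |r| ^ k := by
          gcongr
          exact Real.cosh_le_exp_abs r
      _ ≤ _ := pow_le_pow_right₀ (Real.one_le_exp (abs_nonneg r)) hk
  set K := ∫ r : ℝ, ‖((Real.cosh r ^ n : ℝ) : ℂ) * axisFourier F r‖
  have hK : 0 ≤ K := integral_nonneg fun _ => norm_nonneg _
  refine ⟨(n + 3) * K + 1, by positivity, fun x hx => ?_⟩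
  have hexp : Integrable fun r : ℝ => (Real.exp (-x * Real.cosh r) : ℂ) * axisFourier F r := by
    refine hF.integrable_mul_axisFourier hA hn (by fun_prop) fun r => ?_
    rw [Real.abs_exp, Real.exp_le_exp]
    have := mul_pos hx (Real.cosh_pos r)
    have : 0 ≤ (n : ℝ) * |r| := by positivity
    linarith
  have hterm (k : ℕ) (hk : k ∈ Finset.range n) : Integrable fun r : ℝ =>
      (((-x) ^ k / k.factorial : ℝ) : ℂ) * (((Real.cosh r ^ k : ℝ) : ℂ) * axisFourier F r) :=
    (hpow k (Finset.mem_range.mp hk).le).const_mul _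
  have hsum : ∫ r : ℝ, ∑ k ∈ Finset.range n, (((-x) ^ k / k.factorial : ℝ) : ℂ) *
      (((Real.cosh r ^ k : ℝ) : ℂ) * axisFourier F r) = 0 := by
    rw [integral_finsetSum _ hterm]
    refine Finset.sum_eq_zero fun k hk => ?_
    rw [integral_const_mul, hF.integral_cosh_pow_mul_axisFourier_eq_zero hn hzero k
      (Finset.mem_range.mp hk).le, mul_zero]
  rw [← sub_zero (∫ r : ℝ, _), ← hsum, ← integral_sub hexp (integrable_finsetSum _ hterm)]
  have hle := norm_integral_le_of_norm_le (μ := volume)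
    (f := fun r : ℝ => (Real.exp (-x * Real.cosh r) : ℂ) * axisFourier F r -
      ∑ k ∈ Finset.range n, (((-x) ^ k / k.factorial : ℝ) : ℂ) *
        (((Real.cosh r ^ k : ℝ) : ℂ) * axisFourier F r))
    ((hpow n le_rfl).norm.const_mul ((n + 3) * x ^ n)) (.of_forall fun r => ?_)
  · rw [integral_const_mul] at hle
    refine hle.trans ?_
    have := pow_pos hx n
    linarith
  · have hc := Real.cosh_pos r
    have hT := abs_exp_neg_sub_sum_le n (mul_pos hx hc).le
    have heq : (Real.exp (-x * Real.cosh r) : ℂ) * axisFourier F r -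
        ∑ k ∈ Finset.range n, (((-x) ^ k / k.factorial : ℝ) : ℂ) *
          (((Real.cosh r ^ k : ℝ) : ℂ) * axisFourier F r)
        = ((Real.exp (-(x * Real.cosh r)) -
          ∑ k ∈ Finset.range n, (-(x * Real.cosh r)) ^ k / k.factorial : ℝ) : ℂ) *
          axisFourier F r := by
      rw [ofReal_sub, sub_mul, neg_mul, ofReal_sum, Finset.sum_mul]
      congr 1
      refine Finset.sum_congr rfl fun k _ => ?_
      rw [← neg_mul, mul_pow]
      push_cast
      ring
    rw [heq, norm_mul, norm_mul, norm_real, norm_real, Real.norm_eq_abs, Real.norm_eq_abs,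
      abs_of_pos (pow_pos hc n)]
    refine (mul_le_mul_of_nonneg_right hT (norm_nonneg _)).trans_eq ?_
    ring

end StripDecay

theorem MemCeta.exists_stripDecay {η : ℝ} (hη : 40 < η) {H : ℂ → ℂ} (hH : MemCeta η H) :
    ∃ B : ℝ, StripDecay (fun z => H z * (z * sin (Real.pi * z))) 18 B := by
  obtain ⟨hd, -, C, hC⟩ := hH
  have hsub (z : ℂ) (hz : |z.re| ≤ 18) : |z.re| < 2 * η := by linarith
  refine ⟨|C| * 18, (hd.mono hsub).mul (by fun_prop), fun z hz => ?_⟩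
  have hHz : ‖H z‖ ≤ |C| * Real.exp (-2 * Real.pi * |z.im|) :=
    (hC z (hsub z hz)).trans (by gcongr; exact le_abs_self C)
  have hz' : ‖z‖ ≤ 18 * Real.exp |z.im| := by
    have := norm_le_abs_re_add_abs_im z
    have := Real.add_one_le_exp |z.im|
    linarith [abs_nonneg z.im]
  have hs : ‖sin (Real.pi * z)‖ ≤ Real.exp (Real.pi * |z.im|) := by
    refine (norm_sin_le_exp _).trans_eq ?_
    rw [im_ofReal_mul, abs_mul, abs_of_pos Real.pi_pos]
  rw [norm_mul, norm_mul]
  calc _ ≤ (|C| * Real.exp (-2 * Real.pi * |z.im|)) *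
        ((18 * Real.exp |z.im|) * Real.exp (Real.pi * |z.im|)) := by gcongr
    _ = |C| * 18 * Real.exp (-2 * Real.pi * |z.im| + |z.im| + Real.pi * |z.im|) := by
        rw [Real.exp_add, Real.exp_add]
        ring
    _ ≤ _ := by
        gcongr
        nlinarith [Real.pi_gt_three, abs_nonneg z.im]

theorem StripDecay.integral_mul_KBessel {F : ℂ → ℂ} {A B : ℝ} (hF : StripDecay F A B)
    (hA : 0 ≤ A) {x : ℝ} (hx : 0 < x) :
    ∫ t : ℝ, F (t * I) * (2 * KBessel (t * I) x)
      = ∫ r : ℝ, (Real.exp (-x * Real.cosh r) : ℂ) * axisFourier F r := by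
  have h0 : |(0 : ℝ)| ≤ A := by simpa using hA
  have hi : Integrable fun t : ℝ => F (t * I) := by simpa using hF.integrable h0
  have hprod := hi.mul_prod ((integrable_exp_neg_mul_cosh hx).ofReal (𝕜 := ℂ))
  have hInt : Integrable (Function.uncurry fun t r : ℝ =>
      F (t * I) * ((Real.exp (-x * Real.cosh r) : ℂ) * exp (t * r * I)))
      (volume.prod volume) := by
    refine (hprod.mul_bdd (c := 1) (g := fun p : ℝ × ℝ => exp (p.1 * p.2 * I))
      (Continuous.aestronglyMeasurable (by fun_prop)) (.of_forall fun p => ?_)).congr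
      (.of_forall fun p => ?_)
    · rw [← ofReal_mul, norm_exp_ofReal_mul_I]
    · simp only [Function.uncurry, mul_assoc]
      rfl
  calc _ = ∫ t : ℝ, ∫ r : ℝ,
        F (t * I) * ((Real.exp (-x * Real.cosh r) : ℂ) * exp (t * r * I)) := by
        simp_rw [two_mul_KBessel _ hx, integral_const_mul]
    _ = ∫ r : ℝ, ∫ t : ℝ,
        F (t * I) * ((Real.exp (-x * Real.cosh r) : ℂ) * exp (t * r * I)) :=
        integral_integral_swap hInt
    _ = _ := by
        simp_rw [mul_left_comm (F _), integral_const_mul]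
        rfl

theorem Hflat_eq_integral_axisFourier {H : ℂ → ℂ} {A B : ℝ} (hA : 0 ≤ A)
    (hF : StripDecay (fun z => H z * (z * sin (Real.pi * z))) A B) {y : ℝ} (hy : 0 < y) :
    Hflat H y = -(Real.sqrt y / (4 * Real.pi ^ 2) : ℝ) *
      ∫ r : ℝ, (Real.exp (-(2 * Real.pi * y) * Real.cosh r) : ℂ) *
        axisFourier (fun z => H z * (z * sin (Real.pi * z))) r := by
  have hpi : (Real.pi : ℂ) ≠ 0 := ofReal_ne_zero.mpr Real.pi_ne_zero
  rw [Hflat, ← hF.integral_mul_KBessel hA (by positivity : 0 < 2 * Real.pi * y),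
    ← integral_const_mul, ← integral_const_mul]
  refine integral_congr_ae (.of_forall fun t => ?_)
  simp only [W2, div_eq_mul_inv (H _ * _), inv_Gamma_mul_Gamma_neg]
  push_cast
  field_simp

theorem exists_norm_Hflat_le {η : ℝ} (hη : 40 < η) {H : ℂ → ℂ} (hH : MemCeta η H) {n : ℕ}
    (hn : (n : ℝ) < 18) :
    ∃ C : ℝ, 0 < C ∧ ∀ y : ℝ, 0 < y → ‖Hflat H y‖ ≤ C * y ^ ((n : ℝ) + 1 / 2) := by
  obtain ⟨B, hF⟩ := hH.exists_stripDecay hη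
  obtain ⟨C, hC, hle⟩ := hF.exists_norm_integral_exp_cosh_le hn fun j => by
    rw [mul_comm (Real.pi : ℂ), sin_int_mul_pi, mul_zero, mul_zero]
  have hpi := Real.pi_pos
  refine ⟨C * (2 * Real.pi) ^ n / (4 * Real.pi ^ 2), by positivity, fun y hy => ?_⟩
  rw [Hflat_eq_integral_axisFourier (by norm_num) hF hy, norm_mul, norm_neg, norm_real,
    Real.norm_of_nonneg (by positivity), Real.rpow_add hy, Real.rpow_natCast,
    ← Real.sqrt_eq_rpow]
  refine (mul_le_mul_of_nonneg_left (hle (2 * Real.pi * y) (by positivity))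
    (by positivity)).trans_eq ?_
  rw [mul_pow]
  ring

/-- Since `Hflat H` vanishes to high order at `0`, its Mellin transform is bounded on vertical
strips to the left of the origin. -/
theorem exists_norm_mellinT_Hflat_le {η : ℝ} (hη : 40 < η) {H : ℂ → ℂ} (hH : MemCeta η H) :
    ∃ M : ℝ, 0 < M ∧ ∀ w : ℂ, -16 ≤ w.re → w.re ≤ -11 → ‖mellinT (Hflat H) w‖ ≤ M := by
  obtain ⟨C₀, hC₀, h₀⟩ := exists_norm_Hflat_le hη hH (n := 0) (by norm_num)
  obtain ⟨C₁, hC₁, h₁⟩ := exists_norm_Hflat_le hη hH (n := 17) (by norm_num)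
  set g : ℝ → ℝ := fun y => if y ≤ 1 then C₁ else C₀ * y ^ (-2 : ℝ) with hg
  have hgi : IntegrableOn g (Ioi 0) := by
    rw [← Ioc_union_Ioi_eq_Ioi zero_le_one]
    refine .union ?_ ?_
    · exact (integrableOn_const (C := C₁) (by simp)).congr_fun
        (fun y hy => by simp [hg, hy.2]) measurableSet_Ioc
    · exact IntegrableOn.congr_fun
        ((integrableOn_Ioi_rpow_of_lt (by norm_num : (-2 : ℝ) < -1) one_pos).const_mul C₀)
        (fun y hy => by simp [hg, not_le.mpr (mem_Ioi.mp hy)]) measurableSet_Ioi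
  have hg0 : 0 ≤ ∫ y in Ioi 0, g y := setIntegral_nonneg measurableSet_Ioi fun y hy => by
    have := Real.rpow_nonneg (le_of_lt (mem_Ioi.mp hy)) (-2)
    simp only [hg]
    split_ifs <;> positivity
  refine ⟨(∫ y in Ioi 0, g y) + 1, by linarith, fun w hw₁ hw₂ => ?_⟩
  refine le_trans (norm_integral_le_of_norm_le hgi ?_) (le_add_of_nonneg_right zero_le_one)
  filter_upwards [self_mem_ae_restrict measurableSet_Ioi] with y hy
  have hy : 0 < y := hy
  rw [norm_mul, norm_cpow_eq_rpow_re_of_pos hy, sub_re, one_re]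
  have hpos := Real.rpow_nonneg hy.le (w.re - 1)
  simp only [hg]
  split_ifs with h
  · refine (mul_le_mul_of_nonneg_right (h₁ y hy) hpos).trans ?_
    rw [mul_assoc, ← Real.rpow_add hy]
    refine mul_le_of_le_one_right hC₁.le (Real.rpow_le_one hy.le h ?_)
    push_cast
    linarith
  · refine (mul_le_mul_of_nonneg_right (h₀ y hy) hpos).trans ?_
    rw [mul_assoc, ← Real.rpow_add hy]
    gcongr
    · exact (not_le.mp h).le
    · push_cast
      linarith

/-- Superpolynomial decay of the archimedean transform in `|Im s₀|`, for `φ < π/2`. -/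
theorem Ftrans_decay (η : ℝ) (hη : 40 < η) (H : ℂ → ℂ) (hH : MemCeta η H)
    (α : Fin 3 → ℂ) (hre : ∀ i, (α i).re = 0) (hsum : α 0 + α 1 + α 2 = 0)
    (δ : ℝ) (hδ : δ = 1 ∨ δ = -1) (φ : ℝ) (hφ₁ : 0 < φ) (hφ₂ : φ < Real.pi / 2)
    (T : ℝ) (hT : 1000 ≤ T) :
    ∀ N : ℝ, 0 < N → ∃ C : ℝ, 0 < C ∧ ∀ s0 s : ℂ,
      1/100 < s0.re → s.re < 4 → 0 < 2 * s.re - s0.re - 1/100 → |s.im| < T →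
      ‖FtransPhi α δ φ H s0 s‖ ≤ C * (1 + |s0.im|) ^ (-N) := by
  intro N _
  obtain ⟨M, hM, hmellin⟩ := exists_norm_mellinT_Hflat_le hη hH
  set ε := (Real.pi / 2 - φ) / 8 with hε
  have hε0 : 0 < ε := by rw [hε]; linarith
  obtain ⟨K, hK, hker⟩ := exists_norm_GkerPhi_le hre hδ hφ₁ hε0
    (by rw [hε]; ring) (a := 1 / 200) (by norm_num) T
  obtain ⟨C, hC, hdecay⟩ := exists_exp_neg_mul_le_rpow (c := 2 * ε) (by linarith) N
  have hInt := integrable_exp_neg_mul_abs (c := 2 * ε) (by linarith)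
  set J := ∫ t : ℝ, Real.exp (-(2 * ε) * |t|)
  have hJ : 0 ≤ J := integral_nonneg fun t => (Real.exp_pos _).le
  set D := ‖(1 / (2 * (Real.pi : ℂ))) ^ 2‖ * (M * K * J * J)
  have hD : 0 ≤ D := by positivity
  refine ⟨(D + 1) * C, by positivity, fun s0 s hs0 hs hss0 ht => ?_⟩
  have hinner (t1 : ℝ) : ‖∫ v : ℝ, mellinT (Hflat H) (s - (15 + t1 * I) - 1 / 2) *
      GkerPhi α δ φ (15 + t1 * I) (1 / 100 + v * I) s0 s‖
      ≤ M * K * J * Real.exp (-(2 * ε) * |s0.im|) * Real.exp (-(2 * ε) * |t1|) := by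
    rw [integral_const_mul, integral_GkerPhi_shift hre hδ hφ₁ hφ₂ (by simp) hs0 hs hss0, norm_mul]
    have h1 : ‖mellinT (Hflat H) (s - (15 + t1 * I) - 1 / 2)‖ ≤ M :=
      hmellin _ (by simp; linarith) (by simp; linarith)
    have h2 : ‖∫ v : ℝ, GkerPhi α δ φ (15 + t1 * I) (1 / 200 + v * I) s0 s‖
        ≤ ∫ v : ℝ, K * Real.exp (-(2 * ε) * |s0.im|) * Real.exp (-(2 * ε) * |t1|) *
          Real.exp (-(2 * ε) * |v|) := by
      refine norm_integral_le_of_norm_le (hInt.const_mul _) (.of_forall fun v => ?_)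
      refine (hker (15 + t1 * I) (1 / 200 + v * I) s0 s (by simp) ?_ ?_ ?_ ?_ ?_ hs ?_
        ht.le).trans_eq ?_
      all_goals first | linarith | (simp <;> linarith)
    rw [integral_const_mul] at h2
    exact (mul_le_mul h1 h2 (norm_nonneg _) hM.le).trans_eq (by ring)
  have houter := norm_integral_le_of_norm_le (μ := volume) (hInt.const_mul _) (.of_forall hinner)
  rw [integral_const_mul] at houter
  rw [FtransPhi, norm_mul]
  calc _ ≤ ‖(1 / (2 * (Real.pi : ℂ))) ^ 2‖ *
        (M * K * J * Real.exp (-(2 * ε) * |s0.im|) * J) := by gcongr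
    _ = D * Real.exp (-(2 * ε) * |s0.im|) := by ring
    _ ≤ (D + 1) * (C * (1 + |s0.im|) ^ (-N)) := by
      gcongr
      · linarith
      · exact hdecay _ (abs_nonneg _)
    _ = _ := by ring
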